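/- Let K, N be positive integers, let R̂ ∈ ℝ^{KN×KN} be symmetric positive definite, and let W = (W^{[k]})_{1≤k≤K} be a collection of N×N real matrices each of which is invertible. Then for every n ∈ {1,…,N} the matrix W_n R̂ W_nᵀ is symmetric positive definite, and the function C = (C_1,…,C_N) ↦ J_IVA-G(W,C), restricted to N-tuples of K×K symmetric positive definite matrices, attains its global minimum at the tuple Ĉ(W) given by Ĉ_n(W_n) = (W_n R̂ W_nᵀ)⁻¹ for every n ∈ {1,…,N}. -/

import Mathlib

open Matrix

/-- `blockRow W n` is the K×(K·N) block matrix `W_n` whose k-th row carries the n-th row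
of `W^{[k]}` in the k-th block of columns (columns are indexed by `Fin K × Fin N`). -/
def blockRow {K N : ℕ} (W : Fin K → Matrix (Fin N) (Fin N) ℝ) (n : Fin N) :
    Matrix (Fin K) (Fin K × Fin N) ℝ :=
  Matrix.of fun k p => if p.1 = k then W k n p.2 else 0

/-- The IVA-G cost
`J(W,C) = (1/2)·Σₙ [tr(Cₙ Wₙ R̂ Wₙᵀ) − log det Cₙ] − Σₖ log|det W^{[k]}|`. -/
noncomputable def JIVAG {K N : ℕ} (R : Matrix (Fin K × Fin N) (Fin K × Fin N) ℝ)
    (W : Fin K → Matrix (Fin N) (Fin N) ℝ) (C : Fin N → Matrix (Fin K) (Fin K) ℝ) : ℝ :=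
  (1/2) * ∑ n, ((C n * blockRow W n * R * (blockRow W n)ᵀ).trace - Real.log (C n).det)
    - ∑ k, Real.log |(W k).det|

theorem Matrix.PosDef.log_det_le_trace_sub_card {m : Type*} [Fintype m] [DecidableEq m]
    {M : Matrix m m ℝ} (hM : M.PosDef) :
    Real.log M.det ≤ M.trace - Fintype.card m := by
  have hdet : M.det = ∏ i, hM.isHermitian.eigenvalues i := by
    simpa using hM.isHermitian.det_eq_prod_eigenvalues
  have htr : M.trace = ∑ i, hM.isHermitian.eigenvalues i := by
    simpa using hM.isHermitian.trace_eq_sum_eigenvalues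
  rw [hdet, htr, Real.log_prod fun i _ => (hM.eigenvalues_pos i).ne']
  calc ∑ i, Real.log (hM.isHermitian.eigenvalues i)
      ≤ ∑ i, (hM.isHermitian.eigenvalues i - 1) :=
        Finset.sum_le_sum fun i _ => Real.log_le_sub_one_of_pos (hM.eigenvalues_pos i)
    _ = _ := by simp

theorem Matrix.PosDef.trace_inv_mul_sub_log_det_le {m : Type*} [Fintype m] [DecidableEq m]
    {A C : Matrix m m ℝ} (hA : A.PosDef) (hC : C.PosDef) :
    (A⁻¹ * A).trace - Real.log (A⁻¹).det ≤ (C * A).trace - Real.log C.det := by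
  obtain ⟨B, rfl⟩ : ∃ B : Matrix m m ℝ, C = Bᴴ * B := by
    open scoped MatrixOrder in
    exact CStarAlgebra.nonneg_iff_eq_star_mul_self.mp hC.posSemidef.nonneg
  have hB : IsUnit B := by
    rw [Matrix.isUnit_iff_isUnit_det, isUnit_iff_ne_zero]
    intro h
    simpa [h] using hC.det_pos
  have hM : (B * A * Bᴴ).PosDef :=
    hA.mul_mul_conjTranspose_same (Matrix.vecMul_injective_of_isUnit hB)
  have hdet : (B * A * Bᴴ).det = (Bᴴ * B).det * A.det := by
    simp only [Matrix.det_mul]; ring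
  have htr : (B * A * Bᴴ).trace = (Bᴴ * B * A).trace := by
    rw [Matrix.trace_mul_comm, Matrix.mul_assoc]
  have hlog := hM.log_det_le_trace_sub_card
  rw [hdet, htr, Real.log_mul hC.det_pos.ne' hA.det_pos.ne'] at hlog
  rw [Matrix.nonsing_inv_mul A hA.det_pos.ne'.isUnit, Matrix.trace_one, Matrix.det_nonsing_inv,
    Ring.inverse_eq_inv', Real.log_inv]
  linarith

theorem vecMul_blockRow {K N : ℕ} (W : Fin K → Matrix (Fin N) (Fin N) ℝ) (n : Fin N)
    (v : Fin K → ℝ) (k : Fin K) (j : Fin N) :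
    (v ᵥ* blockRow W n) (k, j) = v k * W k n j := by
  simp [Matrix.vecMul, dotProduct, blockRow]

theorem vecMul_blockRow_injective {K N : ℕ} {W : Fin K → Matrix (Fin N) (Fin N) ℝ}
    (hW : ∀ k, IsUnit (W k).det) (n : Fin N) :
    Function.Injective (blockRow W n).vecMul := by
  intro u v huv
  ext k
  obtain ⟨j, hj⟩ : ∃ j, W k n j ≠ 0 := by
    by_contra! h
    exact (hW k).ne_zero (Matrix.det_eq_zero_of_row_eq_zero n h)
  have hkj : (u ᵥ* blockRow W n) (k, j) = (v ᵥ* blockRow W n) (k, j) := congrFun huv (k, j)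
  rw [vecMul_blockRow, vecMul_blockRow] at hkj
  exact mul_right_cancel₀ hj hkj

theorem blockRow_mul_mul_transpose_posDef {K N : ℕ}
    {R : Matrix (Fin K × Fin N) (Fin K × Fin N) ℝ} (hR : R.PosDef)
    {W : Fin K → Matrix (Fin N) (Fin N) ℝ} (hW : ∀ k, IsUnit (W k).det) (n : Fin N) :
    (blockRow W n * R * (blockRow W n)ᵀ).PosDef := by
  simpa only [Matrix.conjTranspose_eq_transpose_of_trivial] using
    hR.mul_mul_conjTranspose_same (vecMul_blockRow_injective hW n)

/-- if `R̂` is symmetric positive definite and each `W^{[k]}` is invertible,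
then each `Wₙ R̂ Wₙᵀ` is symmetric positive definite, and `C ↦ J_IVA-G(W,C)` restricted to
tuples of symmetric positive definite matrices attains its global minimum at
`Ĉₙ = (Wₙ R̂ Wₙᵀ)⁻¹`. -/
theorem stmt1 (K N : ℕ) (hK : 0 < K) (hN : 0 < N)
    (R : Matrix (Fin K × Fin N) (Fin K × Fin N) ℝ) (hR : R.PosDef)
    (W : Fin K → Matrix (Fin N) (Fin N) ℝ) (hW : ∀ k, IsUnit (W k).det) :
    (∀ n, (blockRow W n * R * (blockRow W n)ᵀ).PosDef) ∧
    (∀ n, ((blockRow W n * R * (blockRow W n)ᵀ)⁻¹).PosDef) ∧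
    (∀ C : Fin N → Matrix (Fin K) (Fin K) ℝ, (∀ n, (C n).PosDef) →
      JIVAG R W (fun n => (blockRow W n * R * (blockRow W n)ᵀ)⁻¹) ≤ JIVAG R W C) := by
  have hA := blockRow_mul_mul_transpose_posDef hR hW
  refine ⟨hA, fun n => (hA n).inv, fun C hC => ?_⟩
  unfold JIVAG
  gcongr _ * ?_ - _
  refine Finset.sum_le_sum fun n _ => ?_
  simpa only [Matrix.mul_assoc] using (hA n).trace_inv_mul_sub_log_det_le (hC n)
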